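/- Let g be the Kac-Moody algebra of an indecomposable symmetrizable generalized Cartan matrix A = (a_{i,j})_{i,j∈I}, and let (I,J) be a C-admissible pair. Set I' = I∖J, h^J = {h∈h : ⟨α_j,h⟩=0 for all j∈J}, α'_k = α_k|_{h^J} for k∈I', Π^J = {α'_k : k∈I'}, Π^{J∨} = {H_k : k∈I'}, and A^J = (a'_{k,l})_{k,l∈I'} with a'_{k,l} = ⟨α_l, H_k⟩. Then A^J is an indecomposable and symmetrizable generalized Cartan matrix, (h^J, Π^J, Π^{J∨}) is a realization of A^J, and corank(A^J) = corank(A). -/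

import Mathlib

attribute [local instance] Classical.propDecidable

noncomputable section

namespace KMG

open Module

/-! ### Generalized Cartan matrices -/

/-- `A` is a generalized Cartan matrix. -/
def IsGCM {I : Type*} (A : Matrix I I ℤ) : Prop :=
  (∀ i, A i i = 2) ∧ (∀ i j, i ≠ j → A i j ≤ 0) ∧ ∀ i j, A i j = 0 → A j i = 0

/-- `A` is indecomposable. -/
def Indecomposable {I : Type*} (A : Matrix I I ℤ) : Prop :=
  ∀ s : Set I, s.Nonempty → sᶜ.Nonempty → ∃ i ∈ s, ∃ j ∈ sᶜ, A i j ≠ 0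

/-- `A` is symmetrizable: `D A` is symmetric for an invertible diagonal matrix `D`. -/
def Symmetrizable {I : Type*} (A : Matrix I I ℤ) : Prop :=
  ∃ d : I → ℚ, (∀ i, d i ≠ 0) ∧ ∀ i j, d i * (A i j : ℚ) = d j * (A j i : ℚ)

/-- The principal submatrix of `A` indexed by a subset `S`. -/
def restrictM {I : Type*} (A : Matrix I I ℤ) (S : Set I) : Matrix S S ℤ :=
  fun i j => A i.1 j.1

/-- `A` is of finite type: `A u > 0` for some `u > 0` (Kac, Thm. 4.3). -/
def IsFiniteType {I : Type*} (A : Matrix I I ℤ) : Prop :=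
  ∃ u : I → ℚ, (∀ i, 0 < u i) ∧ ∀ i, 0 < ∑ᶠ j, (A i j : ℚ) * u j

/-- `A` is of affine type: `A` indecomposable and `A u = 0` for some `u > 0`. -/
def IsAffineType {I : Type*} (A : Matrix I I ℤ) : Prop :=
  Indecomposable A ∧ ∃ u : I → ℚ, (∀ i, 0 < u i) ∧ ∀ i, ∑ᶠ j, (A i j : ℚ) * u j = 0

/-- `A` is of indefinite type: `A u < 0` for some `u > 0`. -/
def IsIndefiniteType {I : Type*} (A : Matrix I I ℤ) : Prop :=
  ∃ u : I → ℚ, (∀ i, 0 < u i) ∧ ∀ i, ∑ᶠ j, (A i j : ℚ) * u j < 0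

/-- The corank of a generalized Cartan matrix. -/
def gcmCorank {I : Type*} [Fintype I] [DecidableEq I] (A : Matrix I I ℤ) : ℕ :=
  Fintype.card I - (A.map ((↑) : ℤ → ℚ)).rank

/-- The connected component of the vertex `k` in the subdiagram of the Dynkin diagram of `A`
with vertex set `S`. -/
def cmpnt {I : Type*} (A : Matrix I I ℤ) (S : Set I) (k : I) : Set I :=
  {i | i ∈ S ∧ Relation.ReflTransGen (fun x y => x ∈ S ∧ y ∈ S ∧ A x y ≠ 0) k i}

/-- `A` is hyperbolic: deleting any one vertex of the Dynkin diagram leaves a disjoint union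
of diagrams of finite or affine type. -/
def IsHyperbolic {I : Type*} (A : Matrix I I ℤ) : Prop :=
  ∀ i₀ k : I, k ≠ i₀ →
    IsFiniteType (restrictM A (cmpnt A {i | i ≠ i₀} k)) ∨
      IsAffineType (restrictM A (cmpnt A {i | i ≠ i₀} k))

/-- `A` is Lorentzian: `A` is nonsingular and its symmetrization has signature `(+,...,+,-)`. -/
def IsLorentzian {I : Type*} [Fintype I] [DecidableEq I] (A : Matrix I I ℤ) : Prop :=
  IsUnit (A.map ((↑) : ℤ → ℚ)).det ∧
    ∃ d : I → ℚ, (∀ i, 0 < d i) ∧ (∀ i j, d i * (A i j : ℚ) = d j * (A j i : ℚ)) ∧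
      ∃ P : Matrix I I ℝ, IsUnit P.det ∧ ∃ i₀ : I,
        P.transpose * (Matrix.of fun i j => ((d i : ℝ) * (A i j : ℝ))) * P =
          Matrix.diagonal fun i => if i = i₀ then (-1 : ℝ) else 1

/-! ### Weight spaces -/

variable {g : Type*} [LieRing g] [LieAlgebra ℂ g]

/-- The weight space of weight `χ` for the adjoint action on `g` of a space `V` mapping to `g`
by `ι`. -/
def wtSpaceι {V : Type*} [AddCommGroup V] [Module ℂ V] (ι : V →ₗ[ℂ] g)
    (χ : Module.Dual ℂ V) : Submodule ℂ g where
  carrier := {x | ∀ v : V, ⁅ι v, x⁆ = χ v • x}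
  add_mem' := fun ha hb v => by rw [lie_add, ha v, hb v, smul_add]
  zero_mem' := fun v => by rw [lie_zero, smul_zero]
  smul_mem' := fun c x hx v => by rw [lie_smul, hx v, smul_comm]

/-! ### Kac-Moody algebras -/

/-- A (symmetrizable) Kac-Moody algebra structure on the Lie algebra `g`, for the generalized
Cartan matrix `A` indexed by `I` : a realization `(H, root, coroot)` of `A` together with
Chevalley generators `e i`, `f i` satisfying the Chevalley-Serre relations, such that `g` is
generated by `H` and the `e i, f i`, is diagonalizable under `H`, with `0`-weight space `H`. -/
structure KacMoodyAlgebra {I : Type*} [Fintype I] [DecidableEq I] (A : Matrix I I ℤ)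
    (g : Type*) [LieRing g] [LieAlgebra ℂ g] : Type _ where
  H : Submodule ℂ g
  root : I → Module.Dual ℂ H
  coroot : I → H
  e : I → g
  f : I → g
  findimH : FiniteDimensional ℂ H
  finrankH : Module.finrank ℂ H = Fintype.card I + gcmCorank A
  indepRoot : LinearIndependent ℂ root
  indepCoroot : LinearIndependent ℂ coroot
  pairing : ∀ i j, root j (coroot i) = (A i j : ℂ)
  abelian : ∀ x y : H, ⁅(x : g), (y : g)⁆ = 0
  lie_e : ∀ (x : H) (i : I), ⁅(x : g), e i⁆ = root i x • e i
  lie_f : ∀ (x : H) (i : I), ⁅(x : g), f i⁆ = -(root i x) • f i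
  e_f : ∀ i j, ⁅e i, f j⁆ = if j = i then ((coroot i : g)) else 0
  serre_e : ∀ i j, i ≠ j →
    ((LieAlgebra.ad ℂ g (e i)) ^ (1 - A i j).toNat) (e j) = 0
  serre_f : ∀ i j, i ≠ j →
    ((LieAlgebra.ad ℂ g (f i)) ^ (1 - A i j).toNat) (f j) = 0
  generates : LieSubalgebra.lieSpan ℂ g ((H : Set g) ∪ Set.range e ∪ Set.range f) = ⊤
  weight_decomp : ⨆ χ : Module.Dual ℂ H, wtSpaceι H.subtype χ = ⊤
  zero_weight : wtSpaceι H.subtype (0 : Module.Dual ℂ H) = H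

variable {I : Type*} [Fintype I] [DecidableEq I] {A : Matrix I I ℤ}

/-- The root system of a Kac-Moody algebra: nonzero weights of the adjoint action of the
Cartan subalgebra. -/
def Delta (G : KacMoodyAlgebra A g) : Set (Module.Dual ℂ G.H) :=
  {χ | χ ≠ 0 ∧ wtSpaceι G.H.subtype χ ≠ ⊥}

/-- The positive roots with respect to the standard root basis. -/
def posRoots (G : KacMoodyAlgebra A g) : Set (Module.Dual ℂ G.H) :=
  {χ ∈ Delta G | ∃ c : I → ℕ, χ = ∑ i, (c i : ℂ) • G.root i}

/-- The real roots : the orbit of the simple roots under the Weyl group. -/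
inductive IsRealRoot (G : KacMoodyAlgebra A g) : Module.Dual ℂ G.H → Prop
  | simple (i : I) : IsRealRoot G (G.root i)
  | reflect (i : I) (χ : Module.Dual ℂ G.H) :
      IsRealRoot G χ → IsRealRoot G (χ - χ (G.coroot i) • G.root i)

/-- The subalgebra `g(S)` generated by the root spaces `g_{± α_i}`, `i ∈ S`. -/
def gS (G : KacMoodyAlgebra A g) (S : Set I) : LieSubalgebra ℂ g :=
  LieSubalgebra.lieSpan ℂ g ({x | ∃ i ∈ S, x = G.e i} ∪ {x | ∃ i ∈ S, x = G.f i})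

/-- The subspace `h^J = {h ∈ h | ⟨α_j, h⟩ = 0 ∀ j ∈ J}`. -/
def hJsub (G : KacMoodyAlgebra A g) (J : Set I) : Submodule ℂ G.H :=
  ⨅ j ∈ J, LinearMap.ker (G.root j)

/-- `Hk` is the canonical semisimple element attached to `k` and the component `S = I_k` :
it lies in the span of the coroots from `S` and satisfies `⟨α_i, H_k⟩ = 2 δ_{i,k}` on `S`. -/
def IsHGen (G : KacMoodyAlgebra A g) (S : Set I) (k : I) (Hk : G.H) : Prop :=
  Hk ∈ Submodule.span ℂ (G.coroot '' S) ∧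
    ∀ i ∈ S, G.root i Hk = if i = k then 2 else 0

/-- `g(S)` is `A₁`-graded by the `sl₂`-triple with semisimple element `Hk` :
`ad Hk` has only eigenvalues `0, 2, -2` on `g(S)`. -/
def A1GradedBy (G : KacMoodyAlgebra A g) (S : Set I) (Hk : g) : Prop :=
  ∀ x ∈ gS G S, x ∈ Module.End.eigenspace (LieAlgebra.ad ℂ g Hk) 0 ⊔
    Module.End.eigenspace (LieAlgebra.ad ℂ g Hk) 2 ⊔
      Module.End.eigenspace (LieAlgebra.ad ℂ g Hk) (-2)

/-- The pair `(I_k, J_k)` (for `I_k` the connected component of `k` in `J ∪ {k}`) is an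
irreducible `C`-admissible pair. -/
def CAdmissibleComponent (G : KacMoodyAlgebra A g) (J : Set I) (k : I) : Prop :=
  IsFiniteType (restrictM A (cmpnt A (J ∪ {k}) k)) ∧
    ∃ Hk : G.H, IsHGen G (cmpnt A (J ∪ {k}) k) k Hk ∧
      ∃ E F : g, E ∈ gS G (cmpnt A (J ∪ {k}) k) ∧ F ∈ gS G (cmpnt A (J ∪ {k}) k) ∧
        IsSl2Triple (Hk : g) E F ∧ A1GradedBy G (cmpnt A (J ∪ {k}) k) (Hk : g)

/-- The data of a `C`-admissible pair `(I, J)` : for each `k ∉ J`, the component `I_k` is of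
finite type and carries an `sl₂`-triple `(E_k, H_k, F_k)` which `A₁`-grades `g(I_k)`. -/
structure CAdmissibleData (G : KacMoodyAlgebra A g) (J : Set I) : Type _ where
  finJ : IsFiniteType (restrictM A J)
  Hc : {k : I // k ∉ J} → G.H
  E : {k : I // k ∉ J} → g
  F : {k : I // k ∉ J} → g
  finIk : ∀ k : {k : I // k ∉ J}, IsFiniteType (restrictM A (cmpnt A (J ∪ {k.1}) k.1))
  isHGen : ∀ k, IsHGen G (cmpnt A (J ∪ {k.1}) k.1) k.1 (Hc k)
  memE : ∀ k, E k ∈ gS G (cmpnt A (J ∪ {k.1}) k.1)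
  memF : ∀ k, F k ∈ gS G (cmpnt A (J ∪ {k.1}) k.1)
  sl2 : ∀ k, IsSl2Triple ((Hc k : g)) (E k) (F k)
  a1 : ∀ k, A1GradedBy G (cmpnt A (J ∪ {k.1}) k.1) ((Hc k : g))

/-- `(I,J)` is a `C`-admissible pair. -/
def CAdmissiblePair (G : KacMoodyAlgebra A g) (J : Set I) : Prop :=
  Nonempty (CAdmissibleData G J)

/-- The data of a `C`-admissible pair `(Itot, J)` for a subdiagram `Itot ⊆ I`. -/
structure CAdmissibleDataIn (G : KacMoodyAlgebra A g) (Itot J : Set I) : Type _ where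
  subJ : J ⊆ Itot
  finJ : IsFiniteType (restrictM A J)
  Hc : {k : I // k ∈ Itot ∧ k ∉ J} → G.H
  E : {k : I // k ∈ Itot ∧ k ∉ J} → g
  F : {k : I // k ∈ Itot ∧ k ∉ J} → g
  finIk : ∀ k : {k : I // k ∈ Itot ∧ k ∉ J},
    IsFiniteType (restrictM A (cmpnt A (J ∪ {k.1}) k.1))
  isHGen : ∀ k, IsHGen G (cmpnt A (J ∪ {k.1}) k.1) k.1 (Hc k)
  memE : ∀ k, E k ∈ gS G (cmpnt A (J ∪ {k.1}) k.1)
  memF : ∀ k, F k ∈ gS G (cmpnt A (J ∪ {k.1}) k.1)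
  sl2 : ∀ k, IsSl2Triple ((Hc k : g)) (E k) (F k)
  a1 : ∀ k, A1GradedBy G (cmpnt A (J ∪ {k.1}) k.1) ((Hc k : g))

/-- The `C`-admissible subalgebra `g^J` : generated by `h^J` and the `E_k, F_k`. -/
def CAdmissibleData.gJ {G : KacMoodyAlgebra A g} {J : Set I} (D : CAdmissibleData G J) :
    LieSubalgebra ℂ g :=
  LieSubalgebra.lieSpan ℂ g
    ((((hJsub G J).map G.H.subtype : Submodule ℂ g) : Set g) ∪ Set.range D.E ∪ Set.range D.F)

/-- `GJ` is "the" Kac-Moody structure on `g^J` associated to a `C`-admissible pair: its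
Cartan subalgebra is `h^J`, its coroots are the `H_k` and its Chevalley generators are the
`E_k, F_k`; the matrix `A'` is `A^J`, i.e. `a'_{k,l} = ⟨α_l, H_k⟩`. -/
def CAdmissibleData.IsAssocKM {G : KacMoodyAlgebra A g} {J : Set I} (D : CAdmissibleData G J)
    {A' : Matrix {k : I // k ∉ J} {k : I // k ∉ J} ℤ}
    (GJ : KacMoodyAlgebra A' ↥D.gJ) : Prop :=
  (∀ k l, (A' k l : ℂ) = G.root l.1 (D.Hc k)) ∧
  GJ.H.map D.gJ.toSubmodule.subtype = (hJsub G J).map G.H.subtype ∧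
  (∀ k, ((GJ.coroot k : ↥D.gJ) : g) = ((D.Hc k : ↥G.H) : g)) ∧
  (∀ k, ((GJ.e k : ↥D.gJ) : g) = D.E k) ∧ (∀ k, ((GJ.f k : ↥D.gJ) : g) = D.F k)

/-! ### Finite gradations -/

/-- `g` is finitely `Σ`-graded, where `Σ` is the root system of the Kac-Moody algebra `m`
(with Kac-Moody structure `M`) and `m` is embedded in `g` by `φ` (the grading subalgebra is
the image of `φ`): `g` is the sum of the weight spaces `V_γ`, `γ ∈ Σ ∪ {0}`, of the adjoint
action of the Cartan subalgebra of `m`, and each `V_γ` is finite dimensional. -/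
def IsFinGrading {S : Type*} [Fintype S] [DecidableEq S] {B : Matrix S S ℤ}
    {m : Type*} [LieRing m] [LieAlgebra ℂ m] (M : KacMoodyAlgebra B m)
    (φ : m →ₗ⁅ℂ⁆ g) : Prop :=
  Function.Injective φ ∧
  (⨆ χ ∈ insert (0 : Module.Dual ℂ M.H) (Delta M),
      wtSpaceι (φ.toLinearMap ∘ₗ M.H.subtype) χ) = ⊤ ∧
  ∀ χ ∈ insert (0 : Module.Dual ℂ M.H) (Delta M),
      FiniteDimensional ℂ (wtSpaceι (φ.toLinearMap ∘ₗ M.H.subtype) χ)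

section Grading

variable {S : Type*} [Fintype S] [DecidableEq S] {B : Matrix S S ℤ}
variable {m : Type*} [LieRing m] [LieAlgebra ℂ m]

/-- The inclusion of the Cartan subalgebra of the grading subalgebra into the Cartan
subalgebra of `g` (given `a ⊆ h`). -/
def cartanIncl (G : KacMoodyAlgebra A g) (M : KacMoodyAlgebra B m) (φ : m →ₗ⁅ℂ⁆ g)
    (hle : M.H.map φ.toLinearMap ≤ G.H) : M.H →ₗ[ℂ] G.H :=
  LinearMap.codRestrict G.H (φ.toLinearMap ∘ₗ M.H.subtype)
    (fun x => hle (Submodule.mem_map_of_mem x.2))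

/-- The restriction `ρ_a(χ)` to the Cartan subalgebra `a` of `m` of a linear form `χ` on `h`. -/
def resD (G : KacMoodyAlgebra A g) (M : KacMoodyAlgebra B m) (φ : m →ₗ⁅ℂ⁆ g)
    (hle : M.H.map φ.toLinearMap ≤ G.H) (χ : Module.Dual ℂ G.H) : Module.Dual ℂ M.H :=
  χ.comp (cartanIncl G M φ hle)

/-- The restriction `ρ_a(α_i)` of the simple root `α_i` to `a`. -/
def resRoot (G : KacMoodyAlgebra A g) (M : KacMoodyAlgebra B m) (φ : m →ₗ⁅ℂ⁆ g)
    (hle : M.H.map φ.toLinearMap ≤ G.H) (i : I) : Module.Dual ℂ M.H :=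
  resD G M φ hle (G.root i)

/-- The root basis of `M` is adapted to the root basis of `G` :
`ρ_a(Δ⁺) ⊆ Σ⁺ ∪ {0}`. -/
def Adapted (G : KacMoodyAlgebra A g) (M : KacMoodyAlgebra B m) (φ : m →ₗ⁅ℂ⁆ g)
    (hle : M.H.map φ.toLinearMap ≤ G.H) : Prop :=
  ∀ χ ∈ posRoots G, resD G M φ hle χ = 0 ∨ resD G M φ hle χ ∈ posRoots M

/-- The set `J = {i ∈ I | ρ_a(α_i) = 0}`. -/
def Jof (G : KacMoodyAlgebra A g) (M : KacMoodyAlgebra B m) (φ : m →ₗ⁅ℂ⁆ g)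
    (hle : M.H.map φ.toLinearMap ≤ G.H) : Set I :=
  {i | resRoot G M φ hle i = 0}

/-- The set `Γ_s = {i ∈ I' | ρ_a(α_i) = γ_s}`. -/
def GammaOf (G : KacMoodyAlgebra A g) (M : KacMoodyAlgebra B m) (φ : m →ₗ⁅ℂ⁆ g)
    (hle : M.H.map φ.toLinearMap ≤ G.H) (s : S) : Set I :=
  {i | resRoot G M φ hle i = M.root s}

/-- The set `I'_re = {i ∈ I' | ρ_a(α_i) ∈ Π_a}`. -/
def IpRe (G : KacMoodyAlgebra A g) (M : KacMoodyAlgebra B m) (φ : m →ₗ⁅ℂ⁆ g)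
    (hle : M.H.map φ.toLinearMap ≤ G.H) : Set I :=
  {i | ∃ s : S, resRoot G M φ hle i = M.root s}

/-- The set `I'_im = {i ∈ I | ρ_a(α_i) ∉ Π_a ∪ {0}}`. -/
def IpIm (G : KacMoodyAlgebra A g) (M : KacMoodyAlgebra B m) (φ : m →ₗ⁅ℂ⁆ g)
    (hle : M.H.map φ.toLinearMap ≤ G.H) : Set I :=
  {i | resRoot G M φ hle i ≠ 0 ∧ ∀ s : S, resRoot G M φ hle i ≠ M.root s}

/-- The set `I_re` : union of the components `I_k`, `k ∈ I'_re`. -/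
def IreOf (G : KacMoodyAlgebra A g) (M : KacMoodyAlgebra B m) (φ : m →ₗ⁅ℂ⁆ g)
    (hle : M.H.map φ.toLinearMap ≤ G.H) : Set I :=
  {i | ∃ k ∈ IpRe G M φ hle, i ∈ cmpnt A (Jof G M φ hle ∪ {k}) k}

/-- `g` is maximally finitely graded: finitely graded, with `a ⊆ h`, the root basis of the
grading subalgebra adapted, and the corresponding sets `J` and `I'_im` empty. -/
def MaxFinGrading (G : KacMoodyAlgebra A g) (M : KacMoodyAlgebra B m) (φ : m →ₗ⁅ℂ⁆ g) : Prop :=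
  IsFinGrading M φ ∧ ∃ hle : M.H.map φ.toLinearMap ≤ G.H,
    Adapted G M φ hle ∧ Jof G M φ hle = ∅ ∧ IpIm G M φ hle = ∅

end Grading

/-- `(π, πv)` is a root basis (with generalized Cartan matrix `B`) of the root system `Rts`. -/
def IsRootBasis {V : Type*} [AddCommGroup V] [Module ℂ V] {S : Type*} [Fintype S]
    (B : Matrix S S ℤ) (Rts : Set (Module.Dual ℂ V)) (π : S → Module.Dual ℂ V)
    (πv : S → V) : Prop :=
  LinearIndependent ℂ π ∧ LinearIndependent ℂ πv ∧
  (∀ s t, π t (πv s) = (B s t : ℂ)) ∧ (∀ s, π s ∈ Rts) ∧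
  ∀ χ ∈ Rts, (∃ c : S → ℕ, χ = ∑ s, (c s : ℂ) • π s) ∨
    (∃ c : S → ℕ, χ = -∑ s, (c s : ℂ) • π s)

/-- `Bf` is a nondegenerate invariant symmetric bilinear form on `g`. -/
def InvariantForm (Bf : g →ₗ[ℂ] g →ₗ[ℂ] ℂ) : Prop :=
  (∀ x y, Bf x y = Bf y x) ∧ (∀ x y z, Bf ⁅x, y⁆ z = Bf x ⁅y, z⁆) ∧
  ∀ x, (∀ y, Bf x y = 0) → x = 0

/-- `Bf` is "the" invariant bilinear form of the Kac-Moody algebra `G` : nondegenerate,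
invariant, symmetric, with `(α_i∨, α_i∨)` a positive rational for all `i`. -/
def NormalizedInvForm (G : KacMoodyAlgebra A g) (Bf : g →ₗ[ℂ] g →ₗ[ℂ] ℂ) : Prop :=
  InvariantForm Bf ∧ ∀ i : I, ∃ q : ℚ, 0 < q ∧ Bf ((G.coroot i : g)) ((G.coroot i : g)) = (q : ℂ)

/-- `(e', f')` is a system of Chevalley generators for `G` (with the given Cartan subalgebra,
simple roots and coroots). -/
def IsChevalleyGens (G : KacMoodyAlgebra A g) (e' f' : I → g) : Prop :=
  (∀ (x : G.H) (i : I), ⁅(x : g), e' i⁆ = G.root i x • e' i) ∧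
  (∀ (x : G.H) (i : I), ⁅(x : g), f' i⁆ = -(G.root i x) • f' i) ∧
  (∀ i j, ⁅e' i, f' j⁆ = if j = i then ((G.coroot i : g)) else 0) ∧
  (∀ i j, i ≠ j → ((LieAlgebra.ad ℂ g (e' i)) ^ (1 - A i j).toNat) (e' j) = 0) ∧
  (∀ i j, i ≠ j → ((LieAlgebra.ad ℂ g (f' i)) ^ (1 - A i j).toNat) (f' j) = 0) ∧
  LieSubalgebra.lieSpan ℂ g ((G.H : Set g) ∪ Set.range e' ∪ Set.range f') = ⊤


/-- The subalgebra `g(I_re)` of `g` generated by `h_{I_re}` and the `e_i, f_i`, `i ∈ I_re`. -/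
def gIre (G : KacMoodyAlgebra A g) (Ire : Set I) (hIre : Submodule ℂ g) : LieSubalgebra ℂ g :=
  LieSubalgebra.lieSpan ℂ g
    ((hIre : Set g) ∪ {x | ∃ i ∈ Ire, x = G.e i} ∪ {x | ∃ i ∈ Ire, x = G.f i})

/-- `GI` is "the" Kac-Moody structure on `g(I_re)` : its Cartan subalgebra is `h_{I_re}`,
its coroots and Chevalley generators are the `α_i∨, e_i, f_i` of `g`, for `i ∈ I_re`. -/
def IsAssocKMIre (G : KacMoodyAlgebra A g) (Ire : Set I) (hIre : Submodule ℂ g)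
    {A'' : Matrix ↥Ire ↥Ire ℤ} (GI : KacMoodyAlgebra A'' ↥(gIre G Ire hIre)) : Prop :=
  GI.H.map (gIre G Ire hIre).toSubmodule.subtype = hIre ∧
  (∀ i, ((GI.coroot i : ↥(gIre G Ire hIre)) : g) = ((G.coroot i.1 : ↥G.H) : g)) ∧
  (∀ i, ((GI.e i : ↥(gIre G Ire hIre)) : g) = G.e i.1) ∧
  (∀ i, ((GI.f i : ↥(gIre G Ire hIre)) : g) = G.f i.1)

/-! ### Admissible quotients and maximal gradations -/

/-- `ρ : I → S` is an admissible quotient map for `A` : fibers are totally disconnected (MG1)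
and the column sums over a fiber are constant along fibers (MG2). -/
def AdmissibleQuotient {I S : Type*} (A : Matrix I I ℤ) (ρ : I → S) : Prop :=
  Function.Surjective ρ ∧
  (∀ k l, k ≠ l → ρ k = ρ l → A k l = 0) ∧
  ∀ s t : S, s ≠ t → ∀ j j', ρ j = t → ρ j' = t →
    ∑ᶠ i ∈ {i | ρ i = s}, A i j = ∑ᶠ i ∈ {i | ρ i = s}, A i j'

section Quotient

variable {S : Type*} [Fintype S] [DecidableEq S]

/-- `γ_s∨ = ∑_{k ∈ Γ_s} α_k∨`. -/
def gammaV (G : KacMoodyAlgebra A g) (ρ : I → S) (s : S) : G.H :=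
  ∑ᶠ k ∈ {k | ρ k = s}, G.coroot k

/-- `X̄_s = ∑_{k ∈ Γ_s} e_k`. -/
def Xbar (G : KacMoodyAlgebra A g) (ρ : I → S) (s : S) : g :=
  ∑ᶠ k ∈ {k | ρ k = s}, G.e k

/-- `Ȳ_s = ∑_{k ∈ Γ_s} f_k`. -/
def Ybar (G : KacMoodyAlgebra A g) (ρ : I → S) (s : S) : g :=
  ∑ᶠ k ∈ {k | ρ k = s}, G.f k

/-- The subalgebra `g^ρ` generated by `a` and the `X̄_s, Ȳ_s`. -/
def gRho (G : KacMoodyAlgebra A g) (ρ : I → S) (a : Submodule ℂ G.H) : LieSubalgebra ℂ g :=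
  LieSubalgebra.lieSpan ℂ g
    (((a.map G.H.subtype : Submodule ℂ g) : Set g) ∪ Set.range (Xbar G ρ) ∪
      Set.range (Ybar G ρ))

/-- `Gρ` is "the" Kac-Moody structure on `g^ρ` : its Cartan subalgebra is `a`, its coroots
are the `γ_s∨` and its Chevalley generators are the `X̄_s, Ȳ_s`. -/
def IsAssocKMrho (G : KacMoodyAlgebra A g) (ρ : I → S) (a : Submodule ℂ G.H)
    {Abar : Matrix S S ℤ} (Gρ : KacMoodyAlgebra Abar ↥(gRho G ρ a)) : Prop :=
  Gρ.H.map (gRho G ρ a).toSubmodule.subtype = a.map G.H.subtype ∧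
  (∀ s, ((Gρ.coroot s : ↥(gRho G ρ a)) : g) = ((gammaV G ρ s : ↥G.H) : g)) ∧
  (∀ s, ((Gρ.e s : ↥(gRho G ρ a)) : g) = Xbar G ρ s) ∧
  (∀ s, ((Gρ.f s : ↥(gRho G ρ a)) : g) = Ybar G ρ s)

end Quotient

end KMG

namespace KMG

open Module

section FiniteType

variable {ι : Type*} [Fintype ι] {B : Matrix ι ι ℤ}

theorem IsFiniteType.exists_mulVec_pos (hB : IsFiniteType B) :
    ∃ u : ι → ℚ, (∀ i, 0 < u i) ∧ ∀ i, 0 < ∑ j, (B i j : ℚ) * u j := by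
  obtain ⟨u, hu, h⟩ := hB
  refine ⟨u, hu, fun i => ?_⟩
  rw [← finsum_eq_sum_of_fintype]
  exact h i

theorem IsFiniteType.nonneg_of_mulVec_nonneg (hoff : ∀ i j, i ≠ j → B i j ≤ 0)
    (hB : IsFiniteType B) {v : ι → ℚ} (hv : ∀ i, 0 ≤ ∑ j, (B i j : ℚ) * v j) (i : ι) :
    0 ≤ v i := by
  obtain ⟨u, hu, hBu⟩ := hB.exists_mulVec_pos
  by_contra! hi
  have : Nonempty ι := ⟨i⟩
  obtain ⟨m, hm⟩ := Finite.exists_min fun j => v j / u j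
  set t := v m / u m with ht
  have ht0 : t < 0 := (hm i).trans_lt (div_neg_of_neg_of_pos hi (hu i))
  have hle : ∀ j, t * u j ≤ v j := fun j => (le_div_iff₀ (hu j)).1 (hm j)
  have heq : v m = t * u m := by rw [ht, div_mul_cancel₀ _ (hu m).ne']
  have h1 : ∑ j, (B m j : ℚ) * (v j - t * u j) ≤ 0 := by
    refine Finset.sum_nonpos fun j _ => ?_
    rcases eq_or_ne m j with rfl | hne
    · rw [heq, sub_self, mul_zero]
    · exact mul_nonpos_of_nonpos_of_nonneg (by exact_mod_cast hoff m j hne)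
        (sub_nonneg.2 (hle j))
  have h2 : ∑ j, (B m j : ℚ) * (v j - t * u j) =
      ∑ j, (B m j : ℚ) * v j - t * ∑ j, (B m j : ℚ) * u j := by
    rw [Finset.mul_sum, ← Finset.sum_sub_distrib]
    exact Finset.sum_congr rfl fun j _ => by ring
  nlinarith [hv m, hBu m, mul_pos_of_neg_of_neg ht0 (neg_neg_of_pos (hBu m))]

theorem IsFiniteType.exists_inverse [DecidableEq ι] (hoff : ∀ i j, i ≠ j → B i j ≤ 0) (hB : IsFiniteType B) :
    ∃ C : Matrix ι ι ℚ, B.map ((↑) : ℤ → ℚ) * C = 1 ∧ C * B.map ((↑) : ℤ → ℚ) = 1 ∧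
      ∀ i j, 0 ≤ C i j := by
  have hinj : Function.Injective (B.map ((↑) : ℤ → ℚ)).mulVec := by
    intro v w hvw
    have hz : ∀ i, ∑ j, (B i j : ℚ) * v j = ∑ j, (B i j : ℚ) * w j := fun i => congrFun hvw i
    funext i
    refine le_antisymm (sub_nonneg.1 (hB.nonneg_of_mulVec_nonneg hoff (v := w - v) ?_ i))
      (sub_nonneg.1 (hB.nonneg_of_mulVec_nonneg hoff (v := v - w) ?_ i)) <;>
    · intro i
      simp [mul_sub, hz i]
  have hU := Matrix.mulVec_injective_iff_isUnit.1 hinj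
  have hdet := (Matrix.isUnit_iff_isUnit_det _).1 hU
  refine ⟨(B.map ((↑) : ℤ → ℚ))⁻¹, Matrix.mul_nonsing_inv _ hdet,
    Matrix.nonsing_inv_mul _ hdet, fun i j => ?_⟩
  refine hB.nonneg_of_mulVec_nonneg hoff (v := fun i => (B.map ((↑) : ℤ → ℚ))⁻¹ i j)
    (fun i => ?_) i
  have h := congrFun (congrFun (Matrix.mul_nonsing_inv _ hdet) i) j
  rw [Matrix.mul_apply] at h
  simp only [Matrix.map_apply] at h
  rw [h, Matrix.one_apply]
  split_ifs <;> norm_num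

theorem IsFiniteType.exists_posDef_bound (hoff : ∀ i j, i ≠ j → B i j ≤ 0)
    (hB : IsFiniteType B) {d : ι → ℚ} (hd : ∀ i, 0 < d i)
    (hs : ∀ i j, d i * (B i j : ℚ) = d j * (B j i : ℚ)) :
    ∃ c : ℚ, 0 < c ∧ ∀ x : ι → ℚ,
      c * ∑ i, x i ^ 2 ≤ ∑ i, ∑ j, d i * (B i j : ℚ) * x i * x j := by
  obtain ⟨u, hu, hBu⟩ := hB.exists_mulVec_pos
  obtain ⟨c, hc, hcle⟩ : ∃ c : ℚ, 0 < c ∧ ∀ i, c ≤ d i * (∑ j, (B i j : ℚ) * u j) / u i := by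
    cases isEmpty_or_nonempty ι
    · exact ⟨1, one_pos, fun i => isEmptyElim i⟩
    · obtain ⟨m, hm⟩ := Finite.exists_min fun i => d i * (∑ j, (B i j : ℚ) * u j) / u i
      exact ⟨_, div_pos (mul_pos (hd m) (hBu m)) (hu m), hm⟩
  refine ⟨c, hc, fun x => ?_⟩
  let T : ι → ι → ℚ := fun i j => d i * (B i j : ℚ) * (x i * x j - u j * x i ^ 2 / u i)
  have hT : 0 ≤ ∑ i, ∑ j, T i j := by
    have hswap : ∑ i, ∑ j, T i j = ∑ i, ∑ j, T j i := Finset.sum_comm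
    have hsum : 0 ≤ ∑ i, ∑ j, (T i j + T j i) := by
      refine Finset.sum_nonneg fun i _ => Finset.sum_nonneg fun j _ => ?_
      have key : T i j + T j i =
          -(d i * (B i j : ℚ)) * (u i * u j * (x i / u i - x j / u j) ^ 2) := by
        have h1 := (hu i).ne'
        have h2 := (hu j).ne'
        simp only [T]
        rw [← hs i j]
        field_simp
        ring
      rw [key]
      rcases eq_or_ne i j with rfl | hne
      · simp
      · have : (B i j : ℚ) ≤ 0 := by exact_mod_cast hoff i j hne
        have h3 : 0 ≤ -(d i * (B i j : ℚ)) := by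
          have := mul_nonneg (hd i).le (neg_nonneg.2 this)
          linarith
        have h1 := (hu i).le
        have h2 := (hu j).le
        positivity
    simp only [Finset.sum_add_distrib] at hsum
    linarith
  have hsplit : ∑ i, ∑ j, d i * (B i j : ℚ) * x i * x j =
      ∑ i, ∑ j, T i j + ∑ i, d i * (∑ j, (B i j : ℚ) * u j) / u i * x i ^ 2 := by
    rw [← Finset.sum_add_distrib]
    refine Finset.sum_congr rfl fun i _ => ?_
    have : d i * (∑ j, (B i j : ℚ) * u j) / u i * x i ^ 2 =
        ∑ j, d i * (B i j : ℚ) * (u j * x i ^ 2 / u i) := by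
      rw [Finset.mul_sum, Finset.sum_div, Finset.sum_mul]
      exact Finset.sum_congr rfl fun j _ => by ring
    rw [this, ← Finset.sum_add_distrib]
    exact Finset.sum_congr rfl fun j _ => by simp only [T]; ring
  rw [hsplit, Finset.mul_sum]
  have : ∑ i, c * x i ^ 2 ≤ ∑ i, d i * (∑ j, (B i j : ℚ) * u j) / u i * x i ^ 2 :=
    Finset.sum_le_sum fun i _ => mul_le_mul_of_nonneg_right (hcle i) (sq_nonneg _)
  linarith

end FiniteType

section Restrict

variable {I : Type*} [Fintype I] {A : Matrix I I ℤ} {S : Set I}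

theorem sum_eq_sum_subtype {M : Type*} [AddCommMonoid M] (S : Set I) [Fintype S] {f : I → M}
    (hf : ∀ i ∉ S, f i = 0) : ∑ i, f i = ∑ i : S, f i :=
  (Fintype.sum_of_injective (Subtype.val : S → I) Subtype.val_injective _ _
    (fun i hi => hf i (by simpa using hi)) fun _ => rfl).symm

theorem IsGCM.restrictM_off {I : Type*} {A : Matrix I I ℤ} (hA : IsGCM A) (S : Set I) (i j : S) (h : i ≠ j) :
    restrictM A S i j ≤ 0 :=
  hA.2.1 _ _ (Subtype.coe_injective.ne h)

theorem IsFiniteType.eq_zero_of_vecMul_eq_zero {K : Type*} [Field K] [CharZero K] (hA : IsGCM A)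
    (hS : IsFiniteType (restrictM A S)) {x : I → K} (hx : ∀ i ∉ S, x i = 0)
    (h : ∀ j ∈ S, ∑ i, x i * (A i j : K) = 0) : x = 0 := by
  obtain ⟨C, hC, -, -⟩ := hS.exists_inverse (hA.restrictM_off S)
  funext i
  by_cases hi : i ∈ S
  swap
  · exact hx i hi
  have hrow : ∀ l : S, ∑ m : S, (A l m : K) * ((C m ⟨i, hi⟩ : ℚ) : K) =
      if l = ⟨i, hi⟩ then 1 else 0 := by
    intro l
    have := congrFun (congrFun hC l) ⟨i, hi⟩
    rw [Matrix.mul_apply, Matrix.one_apply] at this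
    have h2 := congrArg ((↑) : ℚ → K) this
    simpa [restrictM, apply_ite ((↑) : ℚ → K)] using h2
  have h1 : ∑ m : S, (∑ l : S, x l * (A l m : K)) * ((C m ⟨i, hi⟩ : ℚ) : K) = 0 := by
    refine Finset.sum_eq_zero fun m _ => ?_
    rw [← sum_eq_sum_subtype S (f := fun l => x l * (A l m : K)), h m m.2, zero_mul]
    intro l hl
    rw [hx l hl, zero_mul]
  simp only [Finset.sum_mul] at h1
  rw [Finset.sum_comm] at h1
  simp only [mul_assoc, ← Finset.mul_sum, hrow] at h1
  simpa using h1

theorem IsFiniteType.exists_coweight [DecidableEq I] (hA : IsGCM A) (hS : IsFiniteType (restrictM A S)) {k : I}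
    (hk : k ∈ S) : ∃ n : I → ℚ, (∀ i ∉ S, n i = 0) ∧ (∀ i, 0 ≤ n i) ∧
      ∀ j ∈ S, ∑ i, n i * (A i j : ℚ) = if j = k then 2 else 0 := by
  obtain ⟨C, -, hC, hC0⟩ := hS.exists_inverse (hA.restrictM_off S)
  refine ⟨fun i => if hi : i ∈ S then 2 * C ⟨k, hk⟩ ⟨i, hi⟩ else 0, fun i hi => dif_neg hi,
    fun i => ?_, fun j hj => ?_⟩
  · dsimp only
    split_ifs with hi
    · exact mul_nonneg two_pos.le (hC0 _ _)
    · rfl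
  · rw [sum_eq_sum_subtype S]
    · have := congrFun (congrFun hC ⟨k, hk⟩) ⟨j, hj⟩
      rw [Matrix.mul_apply, Matrix.one_apply] at this
      simp only [Subtype.coe_prop, dite_true, Subtype.coe_eta, mul_assoc, ← Finset.mul_sum]
      simp only [restrictM, Matrix.map_apply] at this
      rw [this]
      simp only [Subtype.mk.injEq, eq_comm (a := k)]
      split_ifs <;> norm_num
    · intro i hi
      simp only [dif_neg hi, zero_mul]

theorem coweight_pos [DecidableEq I] {A : Matrix I I ℤ} (hA : IsGCM A) {S : Set I} {k : I} {n : I → ℚ}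
    (hk : k ∈ S) (hn0 : ∀ i, 0 ≤ n i)
    (hn : ∀ j ∈ cmpnt A S k, ∑ i, n i * (A i j : ℚ) = if j = k then 2 else 0) :
    ∀ i ∈ cmpnt A S k, 0 < n i := by
  have hterm : ∀ j, n j = 0 → ∀ i, n i * (A i j : ℚ) ≤ 0 := by
    intro j hj i
    rcases eq_or_ne i j with rfl | hne
    · rw [hj, zero_mul]
    · exact mul_nonpos_of_nonneg_of_nonpos (hn0 i) (by exact_mod_cast hA.2.1 i j hne)
  suffices H : ∀ i, Relation.ReflTransGen (fun x y => x ∈ S ∧ y ∈ S ∧ A x y ≠ 0) k i →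
      i ∈ cmpnt A S k ∧ 0 < n i from fun i hi => (H i hi.2).2
  intro i hi
  induction hi with
  | refl =>
    have hmem : k ∈ cmpnt A S k := ⟨hk, .refl⟩
    refine ⟨hmem, (hn0 k).lt_of_ne fun h0 => ?_⟩
    have h1 := hn k hmem
    have h2 := Finset.sum_nonpos fun i (_ : i ∈ Finset.univ) => hterm k h0.symm i
    rw [h1, if_pos rfl] at h2
    linarith
  | @tail x y hx hxy ih =>
    have hmem : y ∈ cmpnt A S k := ⟨hxy.2.1, ih.1.2.tail hxy⟩
    refine ⟨hmem, (hn0 y).lt_of_ne fun h0 => ?_⟩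
    have h1 := hn y hmem
    have hne : x ≠ y := by
      rintro rfl
      exact ih.2.ne h0
    have hlt : n x * (A x y : ℚ) < 0 := mul_neg_of_pos_of_neg ih.2 (by
      exact_mod_cast (hA.2.1 x y hne).lt_of_ne hxy.2.2)
    have h2 : ∑ i, n i * (A i y : ℚ) < 0 :=
      Finset.sum_neg' (fun i _ => hterm y h0.symm i) ⟨x, Finset.mem_univ x, hlt⟩
    rw [h1] at h2
    split_ifs at h2 <;> linarith

theorem IsFiniteType.exists_coord_bound (hA : IsGCM A) (hS : IsFiniteType (restrictM A S))
    {d : I → ℚ} (hd : ∀ i, 0 < d i) (hs : ∀ i j, d i * (A i j : ℚ) = d j * (A j i : ℚ))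
    (b : I → ℚ) (k : I) : ∃ M : ℤ, ∀ ν : I → ℤ, (∀ i ∉ S, ν i = 0) →
      (∑ i, ∑ j, d i * (A i j : ℚ) * ν i * ν j + ∑ i, b i * ν i ≤ 0) → ν k ≤ M := by
  obtain ⟨c, hc, hQ⟩ := hS.exists_posDef_bound (hA.restrictM_off S) (d := fun i => d i)
    (fun i => hd i) (fun i j => hs i j)
  obtain ⟨M, hM⟩ := exists_int_gt (1 + (∑ i, b i ^ 2) / c ^ 2)
  refine ⟨M, fun ν hν hle => ?_⟩
  have hQν := hQ fun i => (ν i : ℚ)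
  have e1 : ∑ i : S, (ν i : ℚ) ^ 2 = ∑ i, (ν i : ℚ) ^ 2 :=
    (sum_eq_sum_subtype S (f := fun i => (ν i : ℚ) ^ 2) fun i hi => by simp [hν i hi]).symm
  have e2 : ∑ i : S, ∑ j : S, d i * (restrictM A S i j : ℚ) * ν i * ν j =
      ∑ i, ∑ j, d i * (A i j : ℚ) * ν i * ν j := by
    rw [sum_eq_sum_subtype S fun i hi => by simp [hν i hi]]
    refine Finset.sum_congr rfl fun i _ => ?_
    rw [sum_eq_sum_subtype S fun i hi => by simp [hν i hi]]
    rfl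
  rw [e1, e2] at hQν
  have h1 : c * ∑ i, (ν i : ℚ) ^ 2 + ∑ i, b i * ν i ≤ 0 := by linarith
  have h2 : c ^ 2 * ∑ i, (ν i : ℚ) ^ 2 ≤ ∑ i, b i ^ 2 := by
    have h6 : c * (c * ∑ i, (ν i : ℚ) ^ 2 + ∑ i, b i * ν i) ≤ 0 :=
      mul_nonpos_of_nonneg_of_nonpos hc.le h1
    have h8 : ∑ i, (-(c * ν i) * b i) ≤ ∑ i, (1 / 2 * (c * ν i) ^ 2 + 1 / 2 * b i ^ 2) :=
      Finset.sum_le_sum fun i _ => by nlinarith [sq_nonneg (c * ν i + b i)]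
    have h9 : ∑ i, (-(c * ν i) * b i) = - (c * ∑ i, b i * ν i) := by
      rw [Finset.mul_sum, ← Finset.sum_neg_distrib]
      exact Finset.sum_congr rfl fun i _ => by ring
    have h10 : ∑ i, (1 / 2 * (c * (ν i : ℚ)) ^ 2 + 1 / 2 * b i ^ 2) =
        1 / 2 * (c ^ 2 * ∑ i, (ν i : ℚ) ^ 2) + 1 / 2 * ∑ i, b i ^ 2 := by
      rw [Finset.sum_add_distrib, Finset.mul_sum, Finset.mul_sum, Finset.mul_sum]
      congr 1
      exact Finset.sum_congr rfl fun i _ => by ring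
    nlinarith
  have h3 : (ν k : ℚ) ^ 2 ≤ ∑ i, (ν i : ℚ) ^ 2 :=
    Finset.single_le_sum (f := fun i => (ν i : ℚ) ^ 2) (fun i _ => sq_nonneg _)
      (Finset.mem_univ k)
  have h4 : (ν k : ℚ) ^ 2 ≤ (∑ i, b i ^ 2) / c ^ 2 := by
    rw [le_div_iff₀ (by positivity)]
    nlinarith [sq_nonneg c]
  have h5 : (ν k : ℚ) < M := by nlinarith [sq_nonneg ((ν k : ℚ) - 1)]
  exact_mod_cast h5.le

end Restrict

theorem Symmetrizable.exists_pos {I : Type*} {A : Matrix I I ℤ} (hA : IsGCM A)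
    (h : Symmetrizable A) : ∃ d : I → ℚ, (∀ i, 0 < d i) ∧
      ∀ i j, d i * (A i j : ℚ) = d j * (A j i : ℚ) := by
  obtain ⟨d, hd, hs⟩ := h
  refine ⟨fun i => |d i|, fun i => abs_pos.2 (hd i), fun i j => ?_⟩
  rcases eq_or_ne i j with rfl | hne
  · rfl
  have h1 : (A i j : ℚ) ≤ 0 := by exact_mod_cast hA.2.1 i j hne
  have h2 : (A j i : ℚ) ≤ 0 := by exact_mod_cast hA.2.1 j i hne.symm
  have h3 := congrArg abs (hs i j)
  rw [abs_mul, abs_mul, abs_of_nonpos h1, abs_of_nonpos h2] at h3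
  linarith

end KMG

namespace KMG

section Words

variable {g : Type*} [LieRing g] [LieAlgebra ℂ g]
variable {I : Type*} [Fintype I] [DecidableEq I] {A : Matrix I I ℤ}
variable {G : KacMoodyAlgebra A g} {S : Set I} {l : I}

/-- Iterated brackets of the generators `e i`, `i ∈ S`, applied to `e l`, with content `ν`. -/
inductive IsWord (G : KacMoodyAlgebra A g) (S : Set I) (l : I) : (I → ℤ) → g → Prop
  | base : IsWord G S l 0 (G.e l)
  | step (i : I) (hi : i ∈ S) (ν : I → ℤ) (x : g) (hx : IsWord G S l ν x) :
      IsWord G S l (ν + Pi.single i 1) ⁅G.e i, x⁆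

/-- The part of content `ν` of the `g(S)`-module generated by `e l`. -/
def wordSpan (G : KacMoodyAlgebra A g) (S : Set I) (l : I) (ν : I → ℤ) : Submodule ℂ g :=
  Submodule.span ℂ {x | IsWord G S l ν x}

theorem IsWord.nonneg {ν : I → ℤ} {x : g} (h : IsWord G S l ν x) : 0 ≤ ν := by
  induction h with
  | base => exact le_rfl
  | step i hi ν x hx ih => exact add_nonneg ih (Pi.single_nonneg.2 zero_le_one)

theorem IsWord.eq_zero_of_notMem {ν : I → ℤ} {x : g} (h : IsWord G S l ν x) {j : I}
    (hj : j ∉ S) : ν j = 0 := by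
  induction h with
  | base => rfl
  | step i hi ν x hx ih =>
    have : j ≠ i := fun h => hj (h ▸ hi)
    simp [ih, this]

theorem exists_isWord_of_wordSpan_ne_bot {ν : I → ℤ} (h : wordSpan G S l ν ≠ ⊥) :
    ∃ x, IsWord G S l ν x := by
  by_contra! hc
  exact h (Submodule.span_eq_bot.2 fun x hx => (hc x hx).elim)

theorem e_mem_wordSpan : G.e l ∈ wordSpan G S l 0 :=
  Submodule.subset_span .base

theorem lie_e_mem_wordSpan {i : I} (hi : i ∈ S) {ν : I → ℤ} {x : g}
    (hx : x ∈ wordSpan G S l ν) : ⁅G.e i, x⁆ ∈ wordSpan G S l (ν + Pi.single i 1) := by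
  induction hx using Submodule.span_induction with
  | mem x hx => exact Submodule.subset_span (IsWord.step i hi ν x hx)
  | zero => simp
  | add x y _ _ hx hy => rw [lie_add]; exact add_mem hx hy
  | smul c x _ hx => rw [lie_smul]; exact Submodule.smul_mem _ _ hx

theorem lie_h_of_mem_wordSpan (h : G.H) {ν : I → ℤ} {x : g} (hx : x ∈ wordSpan G S l ν) :
    ⁅(h : g), x⁆ = (G.root l h + ∑ i, (ν i : ℂ) * G.root i h) • x := by
  induction hx using Submodule.span_induction with
  | mem x hx =>
    induction hx with
    | base => simp [G.lie_e]
    | step i hi ν x hx ih =>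
      rw [leibniz_lie, G.lie_e, ih, smul_lie, lie_smul, ← add_smul]
      congr 1
      simp only [Pi.add_apply, Int.cast_add, add_mul, Finset.sum_add_distrib, Pi.single_apply]
      simp
      ring
  | zero => simp
  | add x y _ _ hx hy => rw [lie_add, hx, hy, smul_add]
  | smul c x _ hx => rw [lie_smul, hx, smul_comm]

theorem lie_f_mem_wordSpan (hl : l ∉ S) {i : I} (hi : i ∈ S) {ν : I → ℤ} {x : g}
    (hx : x ∈ wordSpan G S l ν) : ⁅G.f i, x⁆ ∈ wordSpan G S l (ν - Pi.single i 1) := by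
  induction hx using Submodule.span_induction with
  | mem x hx =>
    induction hx with
    | base =>
      rw [← lie_skew, G.e_f, if_neg (fun h : i = l => hl (h ▸ hi)), neg_zero]
      exact zero_mem _
    | step j hj ν x hx ih =>
      rw [leibniz_lie, ← lie_skew (G.f i) (G.e j), G.e_f]
      refine add_mem ?_ ?_
      · split_ifs with hij
        · subst hij
          rw [neg_lie, lie_h_of_mem_wordSpan (G.coroot i) (Submodule.subset_span hx),
            add_sub_cancel_right]
          exact neg_mem (Submodule.smul_mem _ _ (Submodule.subset_span hx))
        · simp
      · have := lie_e_mem_wordSpan hj ih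
        rwa [sub_add_eq_add_sub] at this
  | zero => simp
  | add x y _ _ hx hy => rw [lie_add]; exact add_mem hx hy
  | smul c x _ hx => rw [lie_smul]; exact Submodule.smul_mem _ _ hx

theorem e_mem_engel (i j : I) : G.e j ∈ LieSubalgebra.engel ℂ (G.e i) := by
  rcases eq_or_ne i j with rfl | hne
  · exact LieSubalgebra.self_mem_engel ℂ _
  · exact (LieSubalgebra.mem_engel_iff ℂ _ _).2 ⟨_, G.serre_e i j hne⟩

theorem wordSpan_le_engel (i : I) (ν : I → ℤ) :
    wordSpan G S l ν ≤ (LieSubalgebra.engel ℂ (G.e i)).toSubmodule := by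
  refine Submodule.span_le.2 fun x hx => ?_
  induction hx with
  | base => exact e_mem_engel i l
  | step j hj ν x hx ih => exact (LieSubalgebra.engel ℂ (G.e i)).lie_mem (e_mem_engel i j) ih

theorem pow_ad_e_mem_wordSpan {i : I} (hi : i ∈ S) {ν : I → ℤ} {x : g}
    (hx : x ∈ wordSpan G S l ν) (n : ℕ) :
    (LieAlgebra.ad ℂ g (G.e i) ^ n) x ∈ wordSpan G S l (ν + Pi.single i (n : ℤ)) := by
  induction n with
  | zero => simpa using hx
  | succ n ih =>
    rw [pow_succ', Module.End.mul_apply, LieAlgebra.ad_apply, Nat.cast_succ, Pi.single_add,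
      ← add_assoc]
    exact lie_e_mem_wordSpan hi ih

theorem pow_ad_f_mem_wordSpan (hl : l ∉ S) {i : I} (hi : i ∈ S) {ν : I → ℤ} {x : g}
    (hx : x ∈ wordSpan G S l ν) (n : ℕ) :
    (LieAlgebra.ad ℂ g (G.f i) ^ n) x ∈ wordSpan G S l (ν - Pi.single i (n : ℤ)) := by
  induction n with
  | zero => simpa using hx
  | succ n ih =>
    rw [pow_succ', Module.End.mul_apply, LieAlgebra.ad_apply, Nat.cast_succ, Pi.single_add,
      ← sub_sub]
    exact lie_f_mem_wordSpan hl hi ih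

theorem isSl2Triple_simple (hA : IsGCM A) (G : KacMoodyAlgebra A g) (i : I) :
    IsSl2Triple (G.coroot i : g) (G.e i) (G.f i) where
  h_ne_zero h := G.indepCoroot.ne_zero i (Subtype.ext h)
  lie_e_f := by rw [G.e_f, if_pos rfl]
  lie_h_e_nsmul := by
    rw [G.lie_e, G.pairing, hA.1, ← Nat.cast_smul_eq_nsmul ℂ]
    norm_num
  lie_h_f_nsmul := by
    rw [G.lie_f, G.pairing, hA.1, ← Nat.cast_smul_eq_nsmul ℂ, neg_smul]
    norm_num

theorem _root_.IsSl2Triple.HasPrimitiveVectorWith.pow_toEnd_f_ne_zero {L M : Type*} [LieRing L]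
    [LieAlgebra ℂ L] [AddCommGroup M] [Module ℂ M] [LieRingModule L M] [LieModule ℂ L M]
    {h e f : L} {t : IsSl2Triple h e f} {m : M} {q : ℕ}
    (P : t.HasPrimitiveVectorWith m (q : ℂ)) {n : ℕ} (hn : n ≤ q) :
    (LieModule.toEnd ℂ L M f ^ n) m ≠ 0 := by
  induction n with
  | zero => simpa using P.ne_zero
  | succ n ih =>
    intro h0
    have h1 := P.lie_e_pow_succ_toEnd_f n
    rw [h0, lie_zero, eq_comm, smul_eq_zero] at h1
    refine h1.elim (fun h2 => ?_) (ih (Nat.le_of_succ_le hn))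
    rcases mul_eq_zero.1 h2 with h3 | h3
    · exact Nat.cast_add_one_ne_zero n h3
    · have : q = n := by exact_mod_cast sub_eq_zero.1 h3
      omega

theorem wordSpan_reflect_ne_bot (hA : IsGCM A) (hl : l ∉ S) {i : I} (hi : i ∈ S) {ν : I → ℤ}
    (hν : wordSpan G S l ν ≠ ⊥) {p : ℕ} (hp : A i l + ∑ j, A i j * ν j = p) :
    wordSpan G S l (ν - Pi.single i (p : ℤ)) ≠ ⊥ := by
  obtain ⟨x, hx, hx0⟩ := Submodule.exists_mem_ne_zero_of_ne_bot hν
  obtain ⟨m, hm, hm'⟩ := Nat.exists_not_and_succ_of_not_zero_of_exists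
    (p := fun n => (LieAlgebra.ad ℂ g (G.e i) ^ n) x = 0) (by simpa using hx0)
    ((LieSubalgebra.mem_engel_iff ℂ _ _).1 (wordSpan_le_engel i ν hx))
  have hw := pow_ad_e_mem_wordSpan hi hx m
  have P : (isSl2Triple_simple hA G i).HasPrimitiveVectorWith
      ((LieAlgebra.ad ℂ g (G.e i) ^ m) x) ((p + 2 * m : ℕ) : ℂ) :=
    { ne_zero := hm
      lie_h := by
        rw [lie_h_of_mem_wordSpan _ hw]
        congr 1
        have h1 : ∑ j, A i j * (ν + Pi.single i (m : ℤ) : I → ℤ) j = ∑ j, A i j * ν j + 2 * m := by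
          simp [mul_add, Finset.sum_add_distrib, Pi.single_apply, hA.1 i]
        have h2 : A i l + ∑ j, A i j * (ν + Pi.single i (m : ℤ) : I → ℤ) j = (p + 2 * m : ℕ) := by
          rw [h1]; push_cast; linarith
        have h3 := congrArg ((↑) : ℤ → ℂ) h2
        push_cast at h3 ⊢
        rw [← h3]
        simp only [G.pairing]
        congr 1
        exact Finset.sum_congr rfl fun j _ => mul_comm _ _
      lie_e := by
        rw [pow_succ', Module.End.mul_apply] at hm'
        exact hm' }
  have hne := P.pow_toEnd_f_ne_zero (n := m + p) (by omega)
  have hmem := pow_ad_f_mem_wordSpan hl hi hw (m + p)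
  have hcont : ν + Pi.single i (m : ℤ) - Pi.single i ((m + p : ℕ) : ℤ) =
      ν - Pi.single i (p : ℤ) := by
    rw [Nat.cast_add, Pi.single_add]
    abel
  rw [hcont] at hmem
  exact fun hbot => hne ((Submodule.eq_bot_iff _).1 hbot _ hmem)

theorem form_nonpos_of_wordSpan_ne_bot (hA : IsGCM A) (hl : l ∉ S) {d : I → ℚ}
    (hd : ∀ i, 0 < d i) (hs : ∀ i j, d i * (A i j : ℚ) = d j * (A j i : ℚ)) {ν : I → ℤ}
    (hν : wordSpan G S l ν ≠ ⊥) :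
    ∑ i, ∑ j, d i * (A i j : ℚ) * ν i * ν j + ∑ i, (2 * d i * (A i l : ℚ)) * ν i ≤ 0 := by
  obtain ⟨x, hx⟩ := exists_isWord_of_wordSpan_ne_bot hν
  obtain ⟨N, hN⟩ : ∃ N : ℕ, ∑ i, ν i = N :=
    Int.eq_ofNat_of_zero_le (Finset.sum_nonneg fun i _ => hx.nonneg i)
  induction N using Nat.strong_induction_on generalizing ν x with
  | _ N ih =>
  by_cases hpos : ∃ i ∈ S, 0 < A i l + ∑ j, A i j * ν j
  · obtain ⟨i, hi, hp⟩ := hpos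
    obtain ⟨p, hp'⟩ := Int.eq_ofNat_of_zero_le hp.le
    have hne := wordSpan_reflect_ne_bot hA hl hi hν hp'
    obtain ⟨y, hy⟩ := exists_isWord_of_wordSpan_ne_bot hne
    have hsum : ∑ j, (ν - Pi.single i (p : ℤ) : I → ℤ) j = ∑ j, ν j - p := by
      simp [Finset.sum_sub_distrib]
    have hnn : 0 ≤ ∑ j, (ν - Pi.single i (p : ℤ) : I → ℤ) j :=
      Finset.sum_nonneg fun j _ => hy.nonneg j
    have hlow := ih (N - p) (by omega) hne y hy (by omega)
    refine le_trans (le_of_eq ?_) hlow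
    have hpq : ∑ j, (A i j : ℚ) * ν j = p - A i l := by
      have := congrArg ((↑) : ℤ → ℚ) hp'
      push_cast at this
      linarith
    have hrow : ∑ j, d i * (A i j : ℚ) * (ν j : ℚ) = d i * (p - A i l) := by
      rw [← hpq, Finset.mul_sum]
      exact Finset.sum_congr rfl fun j _ => by ring
    have hcol : ∑ j, d j * (A j i : ℚ) * (ν j : ℚ) = d i * (p - A i l) := by
      rw [← hrow]
      exact Finset.sum_congr rfl fun j _ => by rw [hs i j]
    have hcast : ∀ j, (((ν - Pi.single i (p : ℤ) : I → ℤ) j : ℤ) : ℚ) =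
        ν j - if j = i then (p : ℚ) else 0 := by
      intro j
      rw [Pi.sub_apply, Pi.single_apply]
      split_ifs <;> simp
    simp only [hcast, mul_sub, sub_mul, Finset.sum_sub_distrib, mul_ite, ite_mul, mul_zero,
      zero_mul, Finset.sum_ite_eq', Finset.mem_univ, if_true]
    have e1 : ∑ j, ∑ k, (if j = i then d j * (A j k : ℚ) * p * ν k else 0) =
        p * (d i * (p - A i l)) := by
      rw [← hrow, Finset.mul_sum, Finset.sum_comm]
      refine Finset.sum_congr rfl fun j _ => ?_
      simp only [Finset.sum_ite_eq', Finset.mem_univ, if_true]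
      ring
    have e2 : ∑ j, d j * (A j i : ℚ) * ν j * p = p * (d i * (p - A i l)) := by
      rw [← hcol, Finset.mul_sum]
      exact Finset.sum_congr rfl fun j _ => by ring
    rw [e1, e2, hA.1 i]
    push_cast
    ring
  · push Not at hpos
    have h1 : ∀ i, d i * ν i * (A i l + ∑ j, (A i j : ℚ) * ν j) + d i * A i l * ν i ≤ 0 := by
      intro i
      by_cases hi : i ∈ S
      · have h2 : (A i l : ℚ) + ∑ j, (A i j : ℚ) * ν j ≤ 0 := by exact_mod_cast hpos i hi
        have h3 : (A i l : ℚ) ≤ 0 := by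
          exact_mod_cast hA.2.1 i l fun h => hl (h ▸ hi)
        have h4 : (0 : ℚ) ≤ ν i := by exact_mod_cast hx.nonneg i
        have h5 := mul_nonpos_of_nonneg_of_nonpos (mul_nonneg (hd i).le h4) h2
        have h6 := mul_nonpos_of_nonneg_of_nonpos (mul_nonneg (hd i).le h4) h3
        linarith
      · simp [hx.eq_zero_of_notMem hi]
    refine le_trans (le_of_eq ?_) (Finset.sum_nonpos fun i (_ : i ∈ Finset.univ) => h1 i)
    rw [← Finset.sum_add_distrib]
    refine Finset.sum_congr rfl fun i _ => ?_
    rw [mul_add, Finset.mul_sum]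
    have : ∀ j, d i * (A i j : ℚ) * ν i * ν j = d i * ν i * ((A i j : ℚ) * ν j) :=
      fun j => by ring
    simp only [this]
    ring

theorem lie_mem_iSup_wordSpan (hl : l ∉ S) {x y : g} (hx : x ∈ gS G S)
    (hy : y ∈ ⨆ ν, wordSpan G S l ν) : ⁅x, y⁆ ∈ ⨆ ν, wordSpan G S l ν := by
  have hlift : ∀ z : g, (∀ ν, ∀ w ∈ wordSpan G S l ν, ⁅z, w⁆ ∈ ⨆ ν, wordSpan G S l ν) →
      ∀ w ∈ ⨆ ν, wordSpan G S l ν, ⁅z, w⁆ ∈ ⨆ ν, wordSpan G S l ν := by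
    intro z hz
    change (⨆ ν, wordSpan G S l ν) ≤
      (⨆ ν, wordSpan G S l ν).comap (LieAlgebra.ad ℂ g z : g →ₗ[ℂ] g)
    exact iSup_le fun ν w hw => hz ν w hw
  induction hx using LieSubalgebra.lieSpan_induction generalizing y with
  | mem x hx =>
    rcases hx with ⟨i, hi, rfl⟩ | ⟨i, hi, rfl⟩
    · exact hlift _ (fun ν w hw => Submodule.mem_iSup_of_mem _ (lie_e_mem_wordSpan hi hw)) y hy
    · exact hlift _ (fun ν w hw =>
        Submodule.mem_iSup_of_mem _ (lie_f_mem_wordSpan hl hi hw)) y hy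
  | zero => simp
  | add x z _ _ hx hz => rw [add_lie]; exact add_mem (hx hy) (hz hy)
  | smul c x _ hx => rw [smul_lie]; exact Submodule.smul_mem _ _ (hx hy)
  | lie x z _ _ hx hz => rw [lie_lie]; exact sub_mem (hx (hz hy)) (hz (hx hy))

theorem pow_ad_mem_iSup_wordSpan (hl : l ∉ S) {E : g} (hE : E ∈ gS G S) (N : ℕ) :
    (LieAlgebra.ad ℂ g E ^ N) (G.e l) ∈ ⨆ ν, wordSpan G S l ν := by
  induction N with
  | zero => exact Submodule.mem_iSup_of_mem 0 e_mem_wordSpan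
  | succ N ih =>
    rw [pow_succ', Module.End.mul_apply]
    exact lie_mem_iSup_wordSpan hl hE ih

theorem e_ne_zero (hA : IsGCM A) (i : I) : G.e i ≠ 0 :=
  (isSl2Triple_simple hA G i).e_ne_zero

/-- The pairing of a simple root outside `S` with the semisimple element of an `sl₂`-triple in
`g(S)` is a nonpositive integer. -/
theorem root_hgen_eq_neg_nat (hA : IsGCM A) (hSym : Symmetrizable A)
    (hS : IsFiniteType (restrictM A S)) (hl : l ∉ S) {k : I} (hk : k ∈ S) {Hk : G.H}
    (hH : IsHGen G S k Hk) {E F : g} (hE : E ∈ gS G S) (hF : F ∈ gS G S)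
    (t : IsSl2Triple (Hk : g) E F) : ∃ n : ℕ, G.root l Hk = -(n : ℂ) := by
  obtain ⟨d, hd, hs⟩ := hSym.exists_pos hA
  obtain ⟨M, hM⟩ := hS.exists_coord_bound hA hd hs (fun i => 2 * d i * (A i l : ℚ)) k
  set c := G.root l Hk with hc
  have hpair : ∀ ν x, IsWord G S l ν x → ∑ i, (ν i : ℂ) * G.root i Hk = 2 * ν k := by
    intro ν x hx
    rw [Finset.sum_eq_single k]
    · rw [hH.2 k hk, if_pos rfl, mul_comm]
    · intro i _ hik
      by_cases hi : i ∈ S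
      · rw [hH.2 i hi, if_neg hik, mul_zero]
      · rw [hx.eq_zero_of_notMem hi, Int.cast_zero, zero_mul]
    · exact fun h => (h (Finset.mem_univ _)).elim
  have hvanish : ∀ z : ℤ, (z < 0 ∨ M < z) → ∀ x ∈ ⨆ ν, wordSpan G S l ν,
      ⁅(Hk : g), x⁆ = (c + 2 * z : ℂ) • x → x = 0 := by
    intro z hz x hx hzx
    have hle : ⨆ ν, wordSpan G S l ν ≤
        ⨆ μ, ⨆ (_ : μ ≠ c + 2 * z), (LieAlgebra.ad ℂ g (Hk : g)).eigenspace μ := by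
      refine iSup_le fun ν => ?_
      by_cases hν : wordSpan G S l ν = ⊥
      · rw [hν]; exact bot_le
      obtain ⟨y, hy⟩ := exists_isWord_of_wordSpan_ne_bot hν
      have hνM := hM ν (fun i hi => hy.eq_zero_of_notMem hi)
        (form_nonpos_of_wordSpan_ne_bot hA hl hd hs hν)
      have hν0 : 0 ≤ ν k := hy.nonneg k
      have hne : c + 2 * (ν k : ℂ) ≠ c + 2 * z := by
        intro h
        have : ν k = z := by
          have := mul_left_cancel₀ (two_ne_zero) (add_left_cancel h)
          exact_mod_cast this
        omega
      refine le_iSup₂_of_le (c + 2 * (ν k : ℂ)) hne fun w hw => ?_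
      rw [Module.End.mem_eigenspace_iff, LieAlgebra.ad_apply, lie_h_of_mem_wordSpan Hk hw,
        hpair ν y hy]
    have hdisj := (LieAlgebra.ad ℂ g (Hk : g)).eigenspaces_iSupIndep (c + 2 * z)
    exact (Submodule.disjoint_def.1 hdisj) x (Module.End.mem_eigenspace_iff.2 hzx) (hle hx)
  have hFe : ⁅F, G.e l⁆ = 0 := by
    refine hvanish (-1) (Or.inl (by norm_num)) _
      (lie_mem_iSup_wordSpan hl hF (Submodule.mem_iSup_of_mem 0 e_mem_wordSpan)) ?_
    rw [leibniz_lie, t.lie_lie_smul_f ℂ, G.lie_e, lie_smul, neg_lie, smul_lie, ← neg_smul,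
      ← add_smul, ← hc]
    congr 1
    push_cast
    ring
  have P : t.symm.HasPrimitiveVectorWith (G.e l) (-c) :=
    ⟨e_ne_zero hA l, by rw [neg_lie, G.lie_e, neg_smul], hFe⟩
  have hnil : (LieAlgebra.ad ℂ g E ^ (M.toNat + 1)) (G.e l) = 0 := by
    refine hvanish (M.toNat + 1 : ℕ) (Or.inr (by omega)) _ (pow_ad_mem_iSup_wordSpan hl hE _) ?_
    have := P.lie_h_pow_toEnd_f (M.toNat + 1)
    rw [neg_lie, neg_eq_iff_eq_neg, ← neg_smul] at this
    refine Eq.trans this ?_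
    congr 1
    push_cast
    ring
  obtain ⟨n, hn, hn'⟩ := Nat.exists_not_and_succ_of_not_zero_of_exists
    (p := fun n => (LieAlgebra.ad ℂ g E ^ n) (G.e l) = 0) (by simpa using e_ne_zero hA l)
    ⟨_, hnil⟩
  refine ⟨n, ?_⟩
  have h1 := P.lie_e_pow_succ_toEnd_f n
  have h2 : (LieModule.toEnd ℂ g g E ^ (n + 1)) (G.e l) = 0 := hn'
  rw [h2, lie_zero, eq_comm, smul_eq_zero] at h1
  rcases mul_eq_zero.1 (h1.resolve_right hn) with h3 | h3
  · exact (Nat.cast_add_one_ne_zero n h3).elim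
  · linear_combination -h3

end Words

end KMG

namespace KMG

theorem surjective_pi_of_linearIndependent {K V ι : Type*} [Field K] [AddCommGroup V] [Module K V]
    [Fintype ι] {φ : ι → Module.Dual K V} (h : LinearIndependent K φ) :
    Function.Surjective (LinearMap.pi φ) := by
  classical
  rw [← LinearMap.range_eq_top]
  by_contra hne
  obtain ⟨f, hf0, hf⟩ := Submodule.exists_le_ker_of_lt_top _ (lt_top_iff_ne_top.2 hne)
  refine hf0 (LinearMap.pi_ext' fun i => LinearMap.ext_ring ?_)
  have hsum : ∑ i, f (Pi.single i 1) • φ i = 0 := by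
    ext v
    have h1 : f (LinearMap.pi φ v) = 0 := hf (LinearMap.mem_range_self _ v)
    rw [LinearMap.pi_apply_eq_sum_univ f] at h1
    have h2 : ∀ i : ι, (fun j => if i = j then (1 : K) else 0) = Pi.single i 1 := fun i => by
      ext j
      simp [Pi.single_apply, eq_comm]
    simpa [mul_comm, h2] using h1
  simpa using Fintype.linearIndependent_iff.1 h _ hsum i

section Corank

variable {I : Type*} [Fintype I] {A : Matrix I I ℤ}

theorem mem_ker_transpose_mulVecLin {x : I → ℚ} :
    x ∈ LinearMap.ker (A.map ((↑) : ℤ → ℚ)).transpose.mulVecLin ↔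
      ∀ j, ∑ i, x i * (A i j : ℚ) = 0 := by
  rw [LinearMap.mem_ker, funext_iff]
  refine forall_congr' fun j => ?_
  rw [Matrix.mulVecLin_apply, Matrix.mulVec, dotProduct]
  simp [mul_comm]

theorem gcmCorank_eq_finrank_ker [DecidableEq I] (A : Matrix I I ℤ) :
    gcmCorank A =
      Module.finrank ℚ (LinearMap.ker (A.map ((↑) : ℤ → ℚ)).transpose.mulVecLin) := by
  have h := LinearMap.finrank_range_add_finrank_ker (A.map ((↑) : ℤ → ℚ)).transpose.mulVecLin
  have h2 : (A.map ((↑) : ℤ → ℚ)).transpose.rank = (A.map ((↑) : ℤ → ℚ)).rank :=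
    Matrix.rank_transpose _
  rw [Matrix.rank] at h2
  rw [h2, Module.finrank_fintype_fun_eq_card] at h
  rw [gcmCorank]
  omega

variable {J : Set I} {n : {k : I // k ∉ J} → I → ℚ}
  {A' : Matrix {k : I // k ∉ J} {k : I // k ∉ J} ℤ}

theorem sum_notMem_single (hn : ∀ k l, l ∉ J → l ≠ k.1 → n k l = 0) (y : {k : I // k ∉ J} → ℚ)
    (k : {k : I // k ∉ J}) : ∑ m, y m * n m k = y k * n k k :=
  Finset.sum_eq_single k
    (fun m _ hm => by rw [hn m k k.2 fun h => hm (Subtype.ext h.symm), mul_zero])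
    fun h => (h (Finset.mem_univ _)).elim

theorem gcmCorank_eq_of_coweights [DecidableEq I] (hA : IsGCM A) (hJ : IsFiniteType (restrictM A J))
    (hn : ∀ k l, l ∉ J → l ≠ k.1 → n k l = 0) (hnk : ∀ k, n k k ≠ 0)
    (hnJ : ∀ k, ∀ j ∈ J, ∑ i, n k i * (A i j : ℚ) = 0)
    (hA' : ∀ k l, (A' k l : ℚ) = ∑ i, n k i * (A i l : ℚ)) :
    gcmCorank A' = gcmCorank A := by
  rw [gcmCorank_eq_finrank_ker, gcmCorank_eq_finrank_ker]
  let φ := (Matrix.of n).transpose.mulVecLin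
  have hφ : ∀ y i, φ y i = ∑ k, y k * n k i := by
    intro y i
    simp [φ, Matrix.vecMul, dotProduct]
  have hφA : ∀ y j, ∑ i, φ y i * (A i j : ℚ) = ∑ k, y k * ∑ i, n k i * (A i j : ℚ) := by
    intro y j
    simp only [hφ, Finset.sum_mul, Finset.mul_sum, mul_assoc]
    exact Finset.sum_comm
  have hinj : Function.Injective φ := by
    rw [injective_iff_map_eq_zero]
    intro y hy
    funext k
    have := hφ y k
    rw [hy, sum_notMem_single hn] at this
    exact (mul_eq_zero.1 this.symm).resolve_right (hnk k)
  have hmap : (LinearMap.ker (A'.map ((↑) : ℤ → ℚ)).transpose.mulVecLin).map φ =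
      LinearMap.ker (A.map ((↑) : ℤ → ℚ)).transpose.mulVecLin := by
    ext x
    constructor
    · rintro ⟨y, hy, rfl⟩
      rw [SetLike.mem_coe, mem_ker_transpose_mulVecLin] at hy
      rw [mem_ker_transpose_mulVecLin]
      intro j
      rw [hφA]
      by_cases hj : j ∈ J
      · simp [hnJ _ j hj]
      · simpa only [hA'] using hy ⟨j, hj⟩
    · intro hx
      rw [mem_ker_transpose_mulVecLin] at hx
      let y : {k : I // k ∉ J} → ℚ := fun k => x k / n k k
      have hxy : x - φ y = 0 := by
        refine hJ.eq_zero_of_vecMul_eq_zero hA (fun i hi => ?_) fun j hj => ?_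
        · have := hφ y i
          rw [sum_notMem_single hn y ⟨i, hi⟩, div_mul_cancel₀ _ (hnk _)] at this
          rw [Pi.sub_apply, this, sub_self]
        · simp only [Pi.sub_apply, sub_mul, Finset.sum_sub_distrib, hx, hφA, hnJ _ j hj,
            mul_zero, Finset.sum_const_zero, sub_zero]
      rw [sub_eq_zero] at hxy
      refine ⟨y, ?_, hxy.symm⟩
      rw [SetLike.mem_coe, mem_ker_transpose_mulVecLin]
      intro l
      have := hφA y l
      rw [← hxy, hx] at this
      simpa only [hA'] using this.symm
  rw [← hmap]
  exact (Submodule.equivMapOfInjective φ hinj _).finrank_eq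

theorem symmetrizable_of_coweights (hA : IsGCM A) (hSym : Symmetrizable A)
    (hn : ∀ k l, l ∉ J → l ≠ k.1 → n k l = 0) (hnk : ∀ k, n k k ≠ 0)
    (hnJ : ∀ k, ∀ j ∈ J, ∑ i, n k i * (A i j : ℚ) = 0)
    (hA' : ∀ k l, (A' k l : ℚ) = ∑ i, n k i * (A i l : ℚ)) : Symmetrizable A' := by
  obtain ⟨d, hd, hs⟩ := hSym.exists_pos hA
  have hd0 : ∀ i, d i ≠ 0 := fun i => (hd i).ne'
  have hform : ∀ k l, ∑ j, (∑ i, n k i * (A i j : ℚ)) * (n l j / d j) =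
      A' k l * (n l l / d l) := by
    intro k l
    rw [hA', Finset.sum_eq_single l.1]
    · intro j _ hj
      by_cases hjJ : j ∈ J
      · rw [hnJ k j hjJ, zero_mul]
      · rw [hn l j hjJ hj, zero_div, mul_zero]
    · exact fun h => (h (Finset.mem_univ _)).elim
  have hsymm : ∀ k l, A' k l * (n l l / d l) = A' l k * (n k k / d k) := by
    intro k l
    rw [← hform, ← hform]
    simp only [Finset.sum_mul]
    rw [Finset.sum_comm]
    refine Finset.sum_congr rfl fun i _ => Finset.sum_congr rfl fun j _ => ?_
    have h1 := hs i j
    have h2 := hd0 i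
    have h3 := hd0 j
    field_simp
    linear_combination (n k i * n l j) * h1
  refine ⟨fun k => d k / n k k, fun k => div_ne_zero (hd0 k) (hnk k), fun k l => ?_⟩
  have h1 := hsymm k l
  have h2 := hd0 k
  have h3 := hd0 l
  have h4 := hnk k
  have h5 := hnk l
  field_simp at h1 ⊢
  linear_combination h1

end Corank

section Component

variable {I : Type*} {A : Matrix I I ℤ} {J : Set I} {k : I}

theorem self_mem_cmpnt (A : Matrix I I ℤ) (J : Set I) (k : I) : k ∈ cmpnt A (J ∪ {k}) k :=
  ⟨Or.inr rfl, .refl⟩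

theorem notMem_cmpnt {l : I} (hl : l ∉ J) (hlk : l ≠ k) : l ∉ cmpnt A (J ∪ {k}) k :=
  fun h => h.1.elim hl hlk

theorem mem_cmpnt_of_ne_zero {S : Set I} {i j : I} (hi : i ∈ cmpnt A S k) (hj : j ∈ S)
    (h : A i j ≠ 0) : j ∈ cmpnt A S k :=
  ⟨hj, hi.2.tail ⟨hi.1, hj, h⟩⟩

end Component

section Hgen

variable {g : Type*} [LieRing g] [LieAlgebra ℂ g]
variable {I : Type*} [Fintype I] [DecidableEq I] {A : Matrix I I ℤ}
variable {G : KacMoodyAlgebra A g} {S : Set I} {k : I}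

theorem root_sum_smul_coroot (x : I → ℂ) (j : I) :
    G.root j (∑ i, x i • G.coroot i) = ∑ i, x i * (A i j : ℂ) := by
  simp [G.pairing]

theorem IsHGen.eq_sum (hA : IsGCM A) (hS : IsFiniteType (restrictM A S)) {Hk : G.H}
    (hH : IsHGen G S k Hk) {n : I → ℚ} (hn0 : ∀ i ∉ S, n i = 0)
    (hn : ∀ j ∈ S, ∑ i, n i * (A i j : ℚ) = if j = k then 2 else 0) :
    Hk = ∑ i, (n i : ℂ) • G.coroot i := by
  obtain ⟨m, hm0, hm⟩ : ∃ m : I → ℂ, (∀ i ∉ S, m i = 0) ∧ Hk = ∑ i, m i • G.coroot i := by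
    obtain ⟨m, hm, hmk⟩ := (Finsupp.mem_span_image_iff_linearCombination ℂ).1 hH.1
    refine ⟨m, fun i hi => ?_, ?_⟩
    · exact Finsupp.notMem_support_iff.1 fun h => hi ((Finsupp.mem_supported ℂ m).1 hm h)
    · rw [← hmk, Finsupp.linearCombination_apply, Finsupp.sum_fintype _ _ (by simp)]
  have hzero : (m - fun i => (n i : ℂ)) = 0 := by
    refine hS.eq_zero_of_vecMul_eq_zero hA (fun i hi => ?_) fun j hj => ?_
    · simp [hm0 i hi, hn0 i hi]
    · have h1 := hH.2 j hj
      rw [hm, root_sum_smul_coroot] at h1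
      have h2 := congrArg ((↑) : ℚ → ℂ) (hn j hj)
      push_cast at h2
      simp only [Pi.sub_apply, sub_mul, Finset.sum_sub_distrib]
      rw [h1, h2, apply_ite ((↑) : ℚ → ℂ)]
      simp
  rw [hm, sub_eq_zero.1 hzero]

theorem finrank_hJsub_add (G : KacMoodyAlgebra A g) (J : Set I) [Fintype J] :
    Module.finrank ℂ (hJsub G J) + Fintype.card J = Module.finrank ℂ G.H := by
  have := G.findimH
  have hsurj := surjective_pi_of_linearIndependent
    (G.indepRoot.comp (Subtype.val : J → I) Subtype.val_injective)
  have hker : LinearMap.ker (LinearMap.pi (G.root ∘ (Subtype.val : J → I))) = hJsub G J := by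
    rw [LinearMap.ker_pi, hJsub, iInf_subtype]
    rfl
  have h := LinearMap.finrank_range_add_finrank_ker (LinearMap.pi (G.root ∘ (Subtype.val : J → I)))
  rw [LinearMap.range_eq_top.2 hsurj, finrank_top, Module.finrank_fintype_fun_eq_card, hker, add_comm] at h
  exact h

theorem mem_hJsub {J : Set I} {x : G.H} : x ∈ hJsub G J ↔ ∀ j ∈ J, G.root j x = 0 := by
  simp [hJsub, Submodule.mem_iInf]

theorem linearIndependent_root_restrict (G : KacMoodyAlgebra A g) (J : Set I) :
    LinearIndependent ℂ
      (fun k : {k : I // k ∉ J} => (G.root k.1).comp (hJsub G J).subtype) := by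
  rw [Fintype.linearIndependent_iff]
  intro c hc l
  obtain ⟨x, hx⟩ := surjective_pi_of_linearIndependent G.indepRoot (Pi.single l.1 1)
  have hx' : ∀ i, G.root i x = Pi.single (M := fun _ => ℂ) l.1 1 i := fun i => congrFun hx i
  have hxJ : x ∈ hJsub G J := by
    rw [mem_hJsub]
    intro j hj
    rw [hx', Pi.single_eq_of_ne fun h : j = l.1 => l.2 (h ▸ hj)]
  have h := LinearMap.congr_fun hc ⟨x, hxJ⟩
  simpa [hx', Pi.single_apply, Subtype.coe_inj] using h

end Hgen

end KMG


open KMG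

section Statement

attribute [local instance] Classical.propDecidable

variable {I : Type*} [Fintype I] [DecidableEq I] {A : Matrix I I ℤ}
variable {g : Type*} [LieRing g] [LieAlgebra ℂ g]

theorem statement0
    (hGCM : IsGCM A) (hInd : Indecomposable A) (hSym : Symmetrizable A)
    (G : KacMoodyAlgebra A g) (J : Set I) (D : CAdmissibleData G J) :
    ∃ A' : Matrix {k : I // k ∉ J} {k : I // k ∉ J} ℤ,
      (∀ k l, (A' k l : ℂ) = G.root l.1 (D.Hc k)) ∧
      IsGCM A' ∧ Indecomposable A' ∧ Symmetrizable A' ∧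
      (∀ k, D.Hc k ∈ hJsub G J) ∧
      LinearIndependent ℂ D.Hc ∧
      LinearIndependent ℂ
        (fun k : {k : I // k ∉ J} => (G.root k.1).comp (hJsub G J).subtype) ∧
      FiniteDimensional ℂ ↥(hJsub G J) ∧
      Module.finrank ℂ ↥(hJsub G J) =
        Fintype.card {k : I // k ∉ J} + gcmCorank A' ∧
      gcmCorank A' = gcmCorank A := by
  have hcard : Fintype.card {k : I // k ∉ J} + Fintype.card J = Fintype.card I := by
    have h := Fintype.card_subtype_compl (fun k => k ∈ J)
    have h2 := Fintype.card_subtype_le (fun k => k ∈ J)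
    have h3 : Fintype.card {k // k ∈ J} = Fintype.card J := Fintype.card_congr (Equiv.refl _)
    omega
  have hself (k : {k : I // k ∉ J}) := self_mem_cmpnt A J k.1
  have hout (k l : {k : I // k ∉ J}) (h : l ≠ k) : l.1 ∉ cmpnt A (J ∪ {k.1}) k.1 :=
    notMem_cmpnt l.2 fun e => h (Subtype.ext e)
  choose n hn0 hnn hn using fun k => (D.finIk k).exists_coweight hGCM (hself k)
  have hnpos (k : {k : I // k ∉ J}) := coweight_pos hGCM (Or.inr rfl) (hnn k) (hn k)
  have hH (k) := (D.isHGen k).eq_sum hGCM (D.finIk k) (hn0 k) (hn k)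
  have hroot (k j) : G.root j (D.Hc k) = ((∑ i, n k i * (A i j : ℚ) : ℚ) : ℂ) := by
    rw [hH, root_sum_smul_coroot]
    push_cast
    rfl
  have hnJ (k : {k : I // k ∉ J}) : ∀ j ∈ J, ∑ i, n k i * (A i j : ℚ) = 0 := by
    intro j hj
    by_cases hjk : j ∈ cmpnt A (J ∪ {k.1}) k.1
    · rw [hn k j hjk, if_neg fun h : j = k.1 => k.2 (h ▸ hj)]
    · refine Finset.sum_eq_zero fun i _ => ?_
      by_cases hi : i ∈ cmpnt A (J ∪ {k.1}) k.1
      · by_contra h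
        refine hjk (mem_cmpnt_of_ne_zero hi (Or.inl hj) fun h0 => h ?_)
        rw [h0, Int.cast_zero, mul_zero]
      · rw [hn0 k i hi, zero_mul]
  have hn1 (k : {k : I // k ∉ J}) (l : I) (hl : l ∉ J) (hlk : l ≠ k.1) : n k l = 0 :=
    hn0 k l (notMem_cmpnt hl hlk)
  have hnk (k : {k : I // k ∉ J}) : n k k ≠ 0 := (hnpos k k (hself k)).ne'
  have hint : ∀ k l : {k : I // k ∉ J}, ∃ a : ℤ, (a : ℂ) = G.root l.1 (D.Hc k) := by
    intro k l
    rcases eq_or_ne l k with rfl | hlk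
    · refine ⟨2, ?_⟩
      rw [(D.isHGen l).2 l (hself l), if_pos rfl]
      norm_num
    · obtain ⟨m, hm⟩ := root_hgen_eq_neg_nat hGCM hSym (D.finIk k) (hout k l hlk) (hself k)
        (D.isHGen k) (D.memE k) (D.memF k) (D.sl2 k)
      exact ⟨-m, by rw [hm]; push_cast; rfl⟩
  choose A' hA' using hint
  have hA'n (k l) : (A' k l : ℚ) = ∑ i, n k i * (A i l : ℚ) := by
    have := (hA' k l).trans (hroot k l)
    exact_mod_cast this
  have hterm (k l : {k : I // k ∉ J}) (hlk : l ≠ k) (i : I) : n k i * (A i l : ℚ) ≤ 0 := by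
    by_cases hi : i ∈ cmpnt A (J ∪ {k.1}) k.1
    · exact mul_nonpos_of_nonneg_of_nonpos (hnn k i) (by
        exact_mod_cast hGCM.2.1 i l fun h => hout k l hlk (h ▸ hi))
    · rw [hn0 k i hi, zero_mul]
  have hS' : Symmetrizable A' := symmetrizable_of_coweights hGCM hSym hn1 hnk hnJ hA'n
  have hcorank : gcmCorank A' = gcmCorank A :=
    gcmCorank_eq_of_coweights hGCM D.finJ hn1 hnk hnJ hA'n
  have hfin := G.findimH
  refine ⟨A', hA', ⟨fun k => ?_, fun k l hkl => ?_, fun k l hkl => ?_⟩, ?_, hS', fun k => ?_, ?_,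
    linearIndependent_root_restrict G J, inferInstance, ?_, hcorank⟩
  · have h := hA'n k k
    rw [hn k k (hself k), if_pos rfl] at h
    exact_mod_cast h
  · have h : (A' k l : ℚ) ≤ 0 := by
      rw [hA'n]
      exact Finset.sum_nonpos fun i _ => hterm k l hkl.symm i
    exact_mod_cast h
  · obtain ⟨d, hd, hs⟩ := hS'
    have h := hs k l
    rw [hkl, Int.cast_zero, mul_zero, eq_comm] at h
    exact_mod_cast (mul_eq_zero.1 h).resolve_left (hd l)
  · intro s hs hsc
    by_contra! hno
    obtain ⟨k₀, hk₀⟩ := hs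
    obtain ⟨l₀, hl₀⟩ := hsc
    obtain ⟨i, hi, j, hj, hij⟩ := hInd (⋃ k ∈ s, cmpnt A (J ∪ {k.1}) k.1)
      ⟨k₀, Set.mem_biUnion hk₀ (hself k₀)⟩
      ⟨l₀, fun h => by
        obtain ⟨k, hk, hlk⟩ := Set.mem_iUnion₂.1 h
        exact hout k l₀ (fun e => hl₀ (e ▸ hk)) hlk⟩
    obtain ⟨k, hk, hik⟩ := Set.mem_iUnion₂.1 hi
    have hjk : j ∉ cmpnt A (J ∪ {k.1}) k.1 := fun h => hj (Set.mem_biUnion hk h)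
    have hjJ : j ∉ J := fun h => hjk (mem_cmpnt_of_ne_zero hik (Or.inl h) hij)
    have hjs : (⟨j, hjJ⟩ : {k : I // k ∉ J}) ∉ s := fun h =>
      hj (Set.mem_biUnion h (hself ⟨j, hjJ⟩))
    have hne : (⟨j, hjJ⟩ : {k : I // k ∉ J}) ≠ k := fun e => hjs (e ▸ hk)
    have hlt : (A i j : ℚ) < 0 := by
      exact_mod_cast (hGCM.2.1 i j fun e => hjk (e ▸ hik)).lt_of_ne hij
    have hneg : (A' k ⟨j, hjJ⟩ : ℚ) < 0 := by
      rw [hA'n]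
      exact Finset.sum_neg' (fun i _ => hterm k ⟨j, hjJ⟩ hne i)
        ⟨i, Finset.mem_univ i, mul_neg_of_pos_of_neg (hnpos k i hik) hlt⟩
    rw [hno k hk _ hjs, Int.cast_zero] at hneg
    exact hneg.false
  · rw [mem_hJsub]
    intro j hj
    rw [hroot, hnJ k j hj, Rat.cast_zero]
  · rw [Fintype.linearIndependent_iff]
    intro c hc l
    have h1 : ∑ i, (∑ k, c k * (n k i : ℂ)) • G.coroot i = 0 := by
      rw [← hc]
      simp only [hH, Finset.smul_sum, Finset.sum_smul, mul_smul]
      exact Finset.sum_comm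
    have h2 := Fintype.linearIndependent_iff.1 G.indepCoroot _ h1 l.1
    rw [Finset.sum_eq_single l] at h2
    · exact (mul_eq_zero.1 h2).resolve_right (by exact_mod_cast hnk l)
    · intro k _ hkl
      rw [hn1 k l l.2 fun e => hkl (Subtype.ext e.symm), Rat.cast_zero, mul_zero]
    · exact fun h => (h (Finset.mem_univ _)).elim
  · have h1 := finrank_hJsub_add G J
    have h2 := G.finrankH
    omega

end Statement
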